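/- arXiv:2102.01152 — 9 statements merged into one kernel-verified Lean document; each statement's English description precedes it below -/
import Mathlib

section
/- Let Δ₁, …, Δ_l be polytopes in ℝ^N (each the convex hull of a nonempty finite set) such that: (a) every Δ_k has positive dimension (i.e. Δ_k is not a single point); (b) the origin 0 belongs to the intersection ⋂_{k=1}^l Δ_k; (c) 0 belongs to the relative interior of the Minkowski sum Δ₁ + ⋯ + Δ_l. Then 0 belongs to the relative interior of the convex hull of the union Δ₁ ∪ ⋯ ∪ Δ_l. -/
open Pointwise

theorem zero_mem_intrinsicInterior_iff_aux {N : ℕ} (s : Set (Fin N → ℝ)) :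
    (0 : Fin N → ℝ) ∈ intrinsicInterior ℝ s ↔ (0 : Fin N → ℝ) ∈ affineSpan ℝ s ∧
      ∃ ε > 0, ∀ x ∈ affineSpan ℝ s, ‖x‖ < ε → x ∈ s := by
  rw [mem_intrinsicInterior]
  constructor
  · rintro ⟨y, hy, hy0⟩
    rw [mem_interior_iff_mem_nhds, Metric.mem_nhds_iff] at hy
    obtain ⟨ε, hε, hb⟩ := hy
    refine ⟨hy0 ▸ y.2, ε, hε, fun x hx hxε => ?_⟩
    have : (⟨x, hx⟩ : affineSpan ℝ s) ∈ Metric.ball y ε := by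
      rw [Metric.mem_ball, Subtype.dist_eq, hy0, dist_zero_right]
      exact hxε
    exact hb this
  · rintro ⟨h0, ε, hε, h⟩
    refine ⟨⟨0, h0⟩, ?_, rfl⟩
    rw [mem_interior_iff_mem_nhds, Metric.mem_nhds_iff]
    refine ⟨ε, hε, fun y hy => ?_⟩
    rw [Metric.mem_ball, Subtype.dist_eq, dist_zero_right] at hy
    exact h _ y.2 hy

/-- Lemma (lem:0int): if polytopes `Δ k` all have positive dimension, all contain `0`,
and `0` lies in the relative interior of their Minkowski sum, then `0` lies in the
relative interior of the convex hull of their union. -/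
theorem origin_mem_intrinsicInterior_convexHull_union
    (N l : ℕ) (hl : 1 ≤ l)
    (S : Fin l → Finset (Fin N → ℝ)) (hS : ∀ k, (S k).Nonempty)
    (Δ : Fin l → Set (Fin N → ℝ))
    (hΔ : ∀ k, Δ k = convexHull ℝ (S k : Set (Fin N → ℝ)))
    (hdim : ∀ k, ¬ ∃ p, Δ k = {p})
    (h0 : ∀ k, (0 : Fin N → ℝ) ∈ Δ k)
    (hint : (0 : Fin N → ℝ) ∈ intrinsicInterior ℝ (∑ k, Δ k)) :
    (0 : Fin N → ℝ) ∈ intrinsicInterior ℝ (convexHull ℝ (⋃ k, Δ k)) := by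
  have hl' : (0 : ℝ) < l := by exact_mod_cast hl
  have hconv : Convex ℝ (∑ k, Δ k) := by
    have hk : ∀ k, Convex ℝ (Δ k) := fun k => by
      rw [hΔ k]
      exact convex_convexHull ℝ _
    exact Finset.sum_induction _ (Convex ℝ) (fun _ _ ha hb => ha.add hb) convex_zero
      fun k _ => hk k
  have hsub : convexHull ℝ (⋃ k, Δ k) ⊆ ∑ k, Δ k := by
    refine convexHull_min (Set.iUnion_subset fun k x hx => ?_) hconv
    rw [Set.mem_fintype_sum]
    refine ⟨Pi.single k x, fun j => ?_, ?_⟩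
    · by_cases hj : j = k
      · subst hj
        simpa using hx
      · simpa [Pi.single_apply, hj] using h0 j
    · simp
  have h0C : (0 : Fin N → ℝ) ∈ convexHull ℝ (⋃ k, Δ k) :=
    subset_convexHull ℝ _ (Set.mem_iUnion.2 ⟨⟨0, hl⟩, h0 _⟩)
  have h0A := subset_affineSpan ℝ _ h0C
  rw [zero_mem_intrinsicInterior_iff_aux] at hint ⊢
  obtain ⟨-, ε, hε, h⟩ := hint
  refine ⟨h0A, ε / l, div_pos hε hl', fun x hx hxε => ?_⟩
  have hlx : (l : ℝ) • x ∈ affineSpan ℝ (convexHull ℝ (⋃ k, Δ k)) := by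
    have := AffineMap.lineMap_mem (l : ℝ) h0A hx
    simpa [AffineMap.lineMap_apply] using this
  have hM := h _ (affineSpan_mono ℝ hsub hlx) (by
    rw [norm_smul, Real.norm_of_nonneg hl'.le]
    rwa [lt_div_iff₀' hl'] at hxε)
  rw [Set.mem_fintype_sum] at hM
  obtain ⟨g, hg, hgs⟩ := hM
  have hx' : x = ∑ k, (l : ℝ)⁻¹ • g k := by
    rw [← Finset.smul_sum, hgs, smul_smul, inv_mul_cancel₀ hl'.ne', one_smul]
  rw [hx']
  refine (convex_convexHull ℝ _).sum_mem (fun _ _ => by positivity) ?_ fun k _ =>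
    subset_convexHull ℝ _ (Set.mem_iUnion.2 ⟨k, hg k⟩)
  simp [hl'.ne']
end

section
/- Let n, m be positive integers, l ≥ 1, and let Λ₁, …, Λ_l be n × m real matrices with Λ := Λ₁ + ⋯ + Λ_l (entrywise sum). Let x₁, …, x_l ∈ ℝⁿ and c₁, …, c_l, b ∈ ℝ^m be such that c_k ≤ b componentwise for every k, and for every k: Λ_kᵀ·x_k ≥ −c_k componentwise, and Λ_hᵀ·x_k ≥ 0 componentwise for every h ≠ k. Then for every μ₁, …, μ_l ≥ 0 with μ₁ + ⋯ + μ_l = 1, the convex combination x := Σ_k μ_k x_k satisfies Λᵀ·x ≥ −b componentwise. -/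
open Matrix

/-- Key estimate from the proof of Lemma (lem:inclusione): convex combinations of points
`x k`, each satisfying `(Λ k)ᵀ x k ≥ -c k` and `(Λ h)ᵀ x k ≥ 0` for `h ≠ k`, satisfy
`(∑ Λ k)ᵀ x ≥ -b` whenever `c k ≤ b` componentwise. -/
theorem convex_combination_mem_polytope
    (n m l : ℕ) (hn : 0 < n) (hm : 0 < m) (hl : 1 ≤ l)
    (Λ : Fin l → Matrix (Fin n) (Fin m) ℝ)
    (x : Fin l → Fin n → ℝ) (c : Fin l → Fin m → ℝ) (b : Fin m → ℝ)
    (hcb : ∀ k i, c k i ≤ b i)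
    (hx : ∀ k i, -(c k i) ≤ ((Λ k)ᵀ.mulVec (x k)) i)
    (hx' : ∀ k h, h ≠ k → ∀ i, 0 ≤ ((Λ h)ᵀ.mulVec (x k)) i)
    (μ : Fin l → ℝ) (hμ : ∀ k, 0 ≤ μ k) (hμ1 : ∑ k, μ k = 1) :
    ∀ i, -(b i) ≤ ((∑ k, Λ k)ᵀ.mulVec (∑ k, μ k • x k)) i := by
  intro i
  have key : ∀ k, -(b i) ≤ ((∑ h, Λ h)ᵀ.mulVec (x k)) i := by
    intro k
    have e : ((∑ h, Λ h)ᵀ.mulVec (x k)) i = ∑ h, ((Λ h)ᵀ.mulVec (x k)) i := by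
      rw [Matrix.transpose_sum, Matrix.sum_mulVec, Finset.sum_apply]
    rw [e, ← Finset.add_sum_erase _ _ (Finset.mem_univ k)]
    have h1 : 0 ≤ ∑ h ∈ Finset.univ.erase k, ((Λ h)ᵀ.mulVec (x k)) i :=
      Finset.sum_nonneg fun h hh => hx' k h (Finset.ne_of_mem_erase hh) i
    linarith [hx k i, hcb k i]
  have e : ((∑ k, Λ k)ᵀ.mulVec (∑ k, μ k • x k)) i
      = ∑ k, μ k * ((∑ h, Λ h)ᵀ.mulVec (x k)) i := by
    rw [Matrix.mulVec_sum, Finset.sum_apply]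
    simp only [Matrix.mulVec_smul, Pi.smul_apply, smul_eq_mul]
  rw [e]
  calc -(b i) = ∑ k, μ k * (-(b i)) := by rw [← Finset.sum_mul, hμ1, one_mul]
    _ ≤ _ := Finset.sum_le_sum fun k _ => mul_le_mul_of_nonneg_left (key k) (hμ k)
end

section
/- Fix an integer l ≥ 2 and integers m₁, …, m_l with every m_k ≥ 3; set n := (Σ_{k=1}^l m_k) − 1, s_k := Σ_{h<k} m_h, and let I_k := {s_k+1, …, s_k+m_k} be the consecutive blocks partitioning {1, …, n+1}. Fix integers 1 ≤ δ₁ ≤ δ₂ ≤ ⋯ ≤ δ_l and set d_k := m_k − 1 + δ_k. Define a_k ∈ ℤ^{n+1} by (a_k)_i = δ_k if i = s_k + m_k, (a_k)_i = 1 if i ∈ I_k and i ≠ s_k + m_k, and (a_k)_i = 0 otherwise. For each k let Λ_k be the n × (n+1) integer matrix with (i,j)-entry d_k·[i = j] − (a_k)_i for 1 ≤ i ≤ n, 1 ≤ j ≤ n+1 (where [i = j] is 1 if i = j and 0 otherwise). Set Λ := Σ_{k=1}^l Λ_k and let Λ̌ be the n × l(n+1) block matrix (Λ₁ | ⋯ |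 Λ_l). Define b_k ∈ ℤ^{l(n+1)} by: for h = (k−1)(n+1) + p with 1 ≤ p ≤ n+1, (b_k)_h = 1 if p = s_k + m_k and (b_k)_h = δ_k otherwise; and (b_k)_h = 0 for h outside the k-th block. Define b ∈ ℤ^{n+1} by b_i = δ_l for 1 ≤ i ≤ n and b_{n+1} = δ_{l−1}. Set Δ̌_k := {x ∈ ℝⁿ : Λ̌ᵀ·x ≥ −b_k componentwise} and Δ_b := {x ∈ ℝⁿ : Λᵀ·x ≥ −b componentwise}. Then the convex hull of Δ̌₁ ∪ ⋯ ∪ Δ̌_l is contained in Δ_b. -/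
open Matrix

/-- Lemma (lem:inclusione) in the case where every part of the framing partition has
`m k ≥ 3` elements: the convex hull of the polyhedra `Δ̌_{b_k}` is contained in `Δ_b`. -/
theorem convexHull_union_dual_polytopes_subset
    (l : ℕ) (hl : 2 ≤ l) (m : Fin l → ℕ) (hm : ∀ k, 3 ≤ m k)
    (n : ℕ) (hn : n + 1 = ∑ k, m k)
    (δ : Fin l → ℤ) (hδ1 : ∀ k, 1 ≤ δ k) (hδmono : Monotone δ)
    (s : Fin l → ℕ) (hs : ∀ k, s k = ∑ h ∈ Finset.Iio k, m h)
    (d : Fin l → ℤ) (hd : ∀ k, d k = (m k : ℤ) - 1 + δ k)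
    (a : Fin l → Fin (n + 1) → ℤ)
    (ha : ∀ k i, a k i =
      if (i : ℕ) + 1 = s k + m k then δ k
      else if s k ≤ (i : ℕ) ∧ (i : ℕ) < s k + m k then 1 else 0)
    (Λ : Fin l → Matrix (Fin n) (Fin (n + 1)) ℝ)
    (hΛ : ∀ k (i : Fin n) (j : Fin (n + 1)),
      Λ k i j = (d k : ℝ) * (if (i : ℕ) = (j : ℕ) then 1 else 0) - (a k i.castSucc : ℝ))
    (Λtot : Matrix (Fin n) (Fin (n + 1)) ℝ) (hΛtot : Λtot = ∑ k, Λ k)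
    (Λch : Matrix (Fin n) (Fin l × Fin (n + 1)) ℝ)
    (hΛch : ∀ i kj, Λch i kj = Λ kj.1 i kj.2)
    (bk : Fin l → Fin l × Fin (n + 1) → ℝ)
    (hbk : ∀ k kj, bk k kj =
      if kj.1 = k then (if (kj.2 : ℕ) + 1 = s k + m k then 1 else (δ k : ℝ)) else 0)
    (b : Fin (n + 1) → ℝ)
    (hb : ∀ i, b i = if (i : ℕ) < n then (δ ⟨l - 1, by omega⟩ : ℝ)
      else (δ ⟨l - 2, by omega⟩ : ℝ)) :
    convexHull ℝ (⋃ k, {x : Fin n → ℝ | ∀ kj, -(bk k kj) ≤ Λchᵀ.mulVec x kj})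
      ⊆ {x : Fin n → ℝ | ∀ i, -(b i) ≤ Λtotᵀ.mulVec x i} := by
  have hlast : ∀ k : Fin l, (k : ℕ) = l - 1 → s k + m k = n + 1 := by
    intro k hk
    have hu : (Finset.univ : Finset (Fin l)) = insert k (Finset.Iio k) := by
      ext h
      have := h.isLt
      simp only [Finset.mem_univ, Finset.mem_insert, Finset.mem_Iio, true_iff, Fin.ext_iff,
        Fin.lt_def]
      omega
    rw [hn, hs, hu, Finset.sum_insert (by simp), add_comm]
  have hle : ∀ k j, bk k (k, j) ≤ b j := by
    intro k j
    have hk := k.isLt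
    have hj := j.isLt
    have h1 : (1 : ℝ) ≤ δ ⟨l - 1, by omega⟩ := by exact_mod_cast hδ1 _
    have h2 : (1 : ℝ) ≤ δ ⟨l - 2, by omega⟩ := by exact_mod_cast hδ1 _
    rw [hbk, hb]
    simp only [if_true]
    by_cases hjn : (j : ℕ) < n
    · rw [if_pos hjn]
      split_ifs
      · exact h1
      · exact_mod_cast hδmono (Fin.le_def.2 (by simp only []; omega))
    · rw [if_neg hjn]
      split_ifs with h
      · exact h2
      · have : (k : ℕ) ≠ l - 1 := fun hk' => h (by rw [hlast k hk']; omega)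
        exact_mod_cast hδmono (Fin.le_def.2 (by simp only []; omega))
  apply convexHull_min
  · intro x hx
    obtain ⟨k, hk⟩ := Set.mem_iUnion.1 hx
    intro j
    have hsum : Λtotᵀ.mulVec x j = ∑ h, Λchᵀ.mulVec x (h, j) := by
      simp only [Matrix.mulVec, dotProduct, Matrix.transpose_apply, hΛtot, Matrix.sum_apply,
        Finset.sum_mul, hΛch]
      exact Finset.sum_comm
    have hb' : ∑ h, -(bk k (h, j)) = -(bk k (k, j)) := by
      apply Finset.sum_eq_single k
      · intro h _ hne
        rw [hbk, if_neg hne, neg_zero]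
      · simp
    have h3 : ∑ h, -(bk k (h, j)) ≤ ∑ h, Λchᵀ.mulVec x (h, j) :=
      Finset.sum_le_sum fun h _ => hk (h, j)
    have := hle k j
    linarith
  · intro x hx y hy p q hp hq hpq i
    have h1 := mul_le_mul_of_nonneg_left (hx i) hp
    have h2 := mul_le_mul_of_nonneg_left (hy i) hq
    rw [Matrix.mulVec_add, Matrix.mulVec_smul, Matrix.mulVec_smul]
    simp only [Pi.add_apply, Pi.smul_apply, smul_eq_mul]
    have : b i = p * b i + q * b i := by rw [← add_mul, hpq, one_mul]
    linarith
end

section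
/- Let n ≥ 1 and let a = (a₁, …, a_{n+1}) be a vector of positive integers with a₁ ≤ a₂ ≤ ⋯ ≤ a_{n+1} and gcd(a₁, …, a_{n+1}) = 1. Define the polytope Δ_a := {m ∈ ℝⁿ : m_i ≥ −a_i for all 1 ≤ i ≤ n, and Σ_{i=1}^n m_i ≤ a_{n+1}}. Then Σ_{i=1}^{n+1} a_i = n + 1 if and only if the set of lattice points of ℤⁿ lying in the topological interior of Δ_a is exactly {0}. -/
theorem aux_interior (n : ℕ) (hn : 1 ≤ n) (a : Fin (n + 1) → ℤ) (x : Fin n → ℝ) :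
    x ∈ interior {x : Fin n → ℝ |
          (∀ i : Fin n, -(a i.castSucc : ℝ) ≤ x i) ∧ ∑ i, x i ≤ (a (Fin.last n) : ℝ)} ↔
    (∀ i : Fin n, -(a i.castSucc : ℝ) < x i) ∧ ∑ i, x i < (a (Fin.last n) : ℝ) := by
  constructor
  · intro h
    rw [mem_interior_iff_mem_nhds, Metric.mem_nhds_iff] at h
    obtain ⟨e, he, hs⟩ := h
    have key : ∀ t : ℝ, |t| < e → (fun i => x i + t) ∈ Metric.ball x e := by
      intro t ht
      rw [Metric.mem_ball, dist_pi_lt_iff he]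
      intro i
      simpa [Real.dist_eq] using ht
    have h1 := hs (key (-(e/2)) (by rw [abs_neg, abs_of_pos] <;> linarith))
    have h2 := hs (key (e/2) (by rw [abs_of_pos] <;> linarith))
    refine ⟨fun i => ?_, ?_⟩
    · have := h1.1 i
      simp only at this
      linarith
    · have := h2.2
      simp only [Finset.sum_add_distrib, Finset.sum_const, Finset.card_univ, Fintype.card_fin,
        nsmul_eq_mul] at this
      have hn' : (1 : ℝ) ≤ n := by exact_mod_cast hn
      nlinarith
  · intro h
    have ho : IsOpen {x : Fin n → ℝ |
          (∀ i : Fin n, -(a i.castSucc : ℝ) < x i) ∧ ∑ i, x i < (a (Fin.last n) : ℝ)} := by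
      apply IsOpen.and
      · simp only [Set.ofPred_forall]
        exact isOpen_iInter_of_finite fun i => isOpen_lt (by fun_prop) (by fun_prop)
      · exact isOpen_lt (by fun_prop) (by fun_prop)
    refine interior_maximal ?_ ho h
    intro y hy
    exact ⟨fun i => (hy.1 i).le, hy.2.le⟩

/-- Combinatorial core of Proposition (prop:n+1): `|a| = n + 1` iff the origin is the
unique interior lattice point of the polytope `Δ_a`. -/
theorem sum_eq_iff_unique_interior_lattice_point
    (n : ℕ) (hn : 1 ≤ n) (a : Fin (n + 1) → ℤ)
    (hpos : ∀ i, 0 < a i) (hmono : Monotone a)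
    (hgcd : Finset.univ.gcd a = 1) :
    (∑ i, a i = n + 1) ↔
      {p : Fin n → ℤ | (fun i => (p i : ℝ)) ∈
        interior {x : Fin n → ℝ |
          (∀ i : Fin n, -(a i.castSucc : ℝ) ≤ x i) ∧ ∑ i, x i ≤ (a (Fin.last n) : ℝ)}}
        = {0} := by
  have hset : ∀ p : Fin n → ℤ, (fun i => (p i : ℝ)) ∈
        interior {x : Fin n → ℝ |
          (∀ i : Fin n, -(a i.castSucc : ℝ) ≤ x i) ∧ ∑ i, x i ≤ (a (Fin.last n) : ℝ)} ↔
      (∀ i : Fin n, -(a i.castSucc) < p i) ∧ ∑ i, p i < a (Fin.last n) := by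
    intro p
    rw [aux_interior n hn]
    norm_cast
  simp only [hset]
  constructor
  · intro h
    have h1 : ∀ i, a i = 1 := by
      have h0 : ∑ i : Fin (n + 1), (1 : ℤ) = ∑ i, a i := by rw [h]; simp
      have := (Finset.sum_eq_sum_iff_of_le (s := Finset.univ) (f := fun _ => (1 : ℤ)) (g := a)
        (fun i _ => hpos i)).1 h0
      intro i
      have := this i (Finset.mem_univ i)
      omega
    ext p
    simp only [h1, Set.mem_ofPred_eq, Set.mem_singleton_iff]
    constructor
    · rintro ⟨hp, hs⟩
      have hp' : ∀ i ∈ Finset.univ, 0 ≤ p i := fun i _ => by have := hp i; omega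
      have h0 := Finset.sum_nonneg hp'
      have := (Finset.sum_eq_zero_iff_of_nonneg hp').1 (by omega)
      ext i
      exact this i (Finset.mem_univ i)
    · rintro rfl
      simp
  · intro h
    have hl : a (Fin.last n) = 1 := by
      by_contra hne
      have hl := hpos (Fin.last n)
      have hm : (Pi.single ⟨0, hn⟩ 1 : Fin n → ℤ) ∈ ({0} : Set (Fin n → ℤ)) := by
        rw [← h]
        refine ⟨fun i => ?_, ?_⟩
        · have h1 := hpos i.castSucc
          have : (0 : ℤ) ≤ (Pi.single ⟨0, hn⟩ 1 : Fin n → ℤ) i := by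
            rw [Pi.single_apply]; split_ifs <;> simp
          omega
        · rw [Finset.sum_pi_single']
          simp
          omega
      have := congrFun (Set.mem_singleton_iff.1 hm) ⟨0, hn⟩
      simp at this
    have h1 : ∀ i, a i = 1 := fun i => by
      have := hmono (Fin.le_last i)
      have := hpos i
      omega
    simp [h1]
end

section
/- For every integer n ≥ 1 the following identity holds in ℤ: C(2n+1, n+1) − (n+1)² = −(n+1)·C(n, n−1) + Σ_{i=1}^{n} (−1)^{n−i} · C(n+1, i+1) · C(i·n + i − 1, n), where C(·,·) denotes the binomial coefficient. -/
open Polynomial in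
theorem aux_choose_sum (n : ℕ) :
    ∑ k ∈ Finset.range (n + 2), ((-1 : ℤ) ^ (n + 1 - k) * (n + 1).choose k) *
      Ring.choose (((n : ℤ) + 1) * k - (n + 2)) n = 0 := by
  let L : ℤ[X] := C ((n : ℤ) + 1) * X + C (-((n : ℤ) + 2))
  have hd : ((descPochhammer ℤ n).comp L).natDegree < n + 1 := by
    have h1 : L.natDegree ≤ 1 := natDegree_linear_le
    have h2 := natDegree_comp_le (p := descPochhammer ℤ n) (q := L)
    rw [descPochhammer_natDegree] at h2
    nlinarith
  have h := congrFun (Polynomial.fwdDiff_iter_eq_zero_of_degree_lt hd) 0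
  rw [fwdDiff_iter_eq_sum_shift] at h
  have hf : (n.factorial : ℤ) ≠ 0 := by exact_mod_cast n.factorial_ne_zero
  apply mul_left_cancel₀ hf
  rw [mul_zero, Finset.mul_sum]
  refine Eq.trans (Finset.sum_congr rfl fun k _ => ?_) h
  have h3 := Ring.descPochhammer_eq_factorial_smul_choose (((n : ℤ) + 1) * k - (n + 2)) n
  rw [nsmul_eq_mul] at h3
  have h4 : ((descPochhammer ℤ n).comp L).eval (0 + k • (1 : ℤ))
      = (descPochhammer ℤ n).smeval (((n : ℤ) + 1) * k - (n + 2)) := by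
    rw [← aeval_eq_smeval, eval_comp, coe_aeval_eq_eval]
    simp [L, sub_eq_add_neg]
  rw [h4, h3, smul_eq_mul]
  ring

/-- Numerical identity underlying Theorem (thm:B-mirror0): the number of complex moduli
of degree `n+1` hypersurfaces in `ℙⁿ` equals the Hodge number `h¹(Ω_{Ŷ∨})` of the
resolved f-mirror. -/
theorem moduli_eq_hodge_number_CY
    (n : ℕ) (hn : 1 ≤ n) :
    ((2 * n + 1).choose (n + 1) : ℤ) - (n + 1) ^ 2
      = -(n + 1) * (n.choose (n - 1))
        + ∑ i ∈ Finset.Icc 1 n,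
            (-1 : ℤ) ^ (n - i) * ((n + 1).choose (i + 1)) * ((i * n + i - 1).choose n) := by
  have h := aux_choose_sum n
  rw [Finset.sum_range_succ', Finset.sum_range_succ'] at h
  have e : ∑ i ∈ Finset.Icc 1 n,
      (-1 : ℤ) ^ (n - i) * ((n + 1).choose (i + 1)) * ((i * n + i - 1).choose n)
      = ∑ k ∈ Finset.range n, ((-1 : ℤ) ^ (n + 1 - (k + 1 + 1)) * (n + 1).choose (k + 1 + 1)) *
      Ring.choose (((n : ℤ) + 1) * ((k + 1 + 1 : ℕ) : ℤ) - (n + 2)) n := by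
    rw [Finset.range_eq_Ico, Finset.sum_Ico_add' (fun i => ((-1 : ℤ) ^ (n + 1 - (i + 1)) *
      (n + 1).choose (i + 1)) * Ring.choose (((n : ℤ) + 1) * ((i + 1 : ℕ) : ℤ) - (n + 2)) n) 0 n 1]
    refine Finset.sum_congr (by ext; simp) fun i hi => ?_
    have hi1 : 1 ≤ i := by have := (Finset.mem_Ico.mp hi).1; omega
    rw [← Ring.choose_natCast (R := ℤ) (i * n + i - 1) n, Nat.add_sub_add_right]
    congr 2
    rw [Nat.cast_sub (by omega)]
    push_cast
    ring
  rw [e]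
  have s : Int.negOnePow n • (1 : ℤ) = (-1) ^ n := by
    simp [Units.smul_def, Int.negOnePow]
  have f0 : Ring.choose (((n : ℤ) + 1) * ((0 : ℕ) : ℤ) - (n + 2)) n
      = (-1) ^ n * ((2 * n + 1).choose (n + 1) : ℤ) := by
    have : ((n : ℤ) + 1) * ((0 : ℕ) : ℤ) - (n + 2) = -((n : ℤ) + 2) := by simp
    rw [this, Ring.choose_neg, show (n : ℤ) + 2 + n - 1 = ((2 * n + 1 : ℕ) : ℤ) by push_cast; ring,
      Ring.choose_natCast, ← Nat.choose_symm_half, ← s, smul_mul_assoc, one_mul]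
  have f1 : Ring.choose (((n : ℤ) + 1) * ((0 + 1 : ℕ) : ℤ) - (n + 2)) n = (-1) ^ n := by
    have : ((n : ℤ) + 1) * ((0 + 1 : ℕ) : ℤ) - (n + 2) = -1 := by push_cast; ring
    rw [this, Ring.choose_neg, show (1 : ℤ) + n - 1 = (n : ℤ) by ring,
      Ring.choose_natCast, Nat.choose_self, ← s, Nat.cast_one]
  rw [f0, f1] at h
  have hc : n.choose (n - 1) = n := by
    rw [Nat.choose_symm hn, Nat.choose_one_right]
  have hs : (-1 : ℤ) ^ n * (-1) ^ n = 1 := by rw [← mul_pow]; simp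
  rw [hc]
  simp only [Nat.sub_zero, zero_add, Nat.add_sub_cancel, Nat.choose_zero_right,
    Nat.choose_one_right, pow_succ (-1 : ℤ) n] at h
  push_cast at h ⊢
  linear_combination -h - (((2 * n + 1).choose (n + 1) : ℤ) - (n + 1)) * hs
end

section
/- For all integers n ≥ 1 and d ≥ n + 1 the following identity holds in ℤ: C(2d−1, n) − (n+1)·C(d−1, n) = Σ_{i=1}^{n} (−1)^{n−i} · C(n+1, i+1) · C(i·d − d + n, n), where C(·,·) denotes the binomial coefficient. -/
theorem combinatorial_lemma
    (n d : ℕ) (hn : 1 ≤ n) (hd : n + 1 ≤ d) :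
    ((2 * d - 1).choose n : ℤ) - (n + 1) * ((d - 1).choose n)
      = ∑ i ∈ Finset.Icc 1 n,
          (-1 : ℤ) ^ (n - i) * ((n + 1).choose (i + 1)) * ((i * d - d + n).choose n) := by
  have hneg : ∀ m : ℕ, (ascPochhammer ℤ n).eval (-(m : ℤ))
      = (-1) ^ n * ((n.factorial : ℤ) * (m.choose n : ℤ)) := by
    intro m
    rw [ascPochhammer_eval_neg_eq_descPochhammer, descPochhammer_eval_eq_descFactorial,
      Nat.descFactorial_eq_factorial_mul_choose]
    push_cast
    ring
  have hpos : ∀ m : ℕ, (ascPochhammer ℤ n).eval ((m : ℤ) + 1)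
      = (n.factorial : ℤ) * ((m + n).choose n : ℤ) := by
    intro m
    have h := ascPochhammer_nat_eq_ascFactorial (m + 1) n
    rw [Nat.ascFactorial_eq_factorial_mul_choose] at h
    have h2 := ascPochhammer_eval_cast (S := ℤ) n (m + 1)
    rw [h] at h2
    push_cast at h2
    exact h2.symm
  let P : Polynomial ℤ := (ascPochhammer ℤ n).comp
    (Polynomial.C (d : ℤ) * Polynomial.X + Polynomial.C (1 - 2 * (d : ℤ)))
  have hP : P.natDegree < n + 1 := by
    have h1 : P.natDegree ≤ n * 1 := by
      refine Polynomial.natDegree_comp_le.trans ?_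
      rw [ascPochhammer_natDegree]
      exact Nat.mul_le_mul_left _ Polynomial.natDegree_linear_le
    omega
  have key := congrFun (Polynomial.fwdDiff_iter_eq_zero_of_degree_lt hP) 0
  rw [fwdDiff_iter_eq_sum_shift, Finset.sum_range_succ', Finset.sum_range_succ'] at key
  have e0 : P.eval 0 = (-1) ^ n * ((n.factorial : ℤ) * ((2 * d - 1).choose n : ℤ)) := by
    rw [← hneg, Nat.cast_sub (by omega)]
    simp [P]
  have e1 : P.eval 1 = (-1) ^ n * ((n.factorial : ℤ) * ((d - 1).choose n : ℤ)) := by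
    rw [← hneg, Nat.cast_sub (by omega)]
    simp only [P, Polynomial.eval_comp]
    congr 1
    simp
    ring
  have e2 : ∀ k : ℕ, P.eval ((k : ℤ) + 2) = (n.factorial : ℤ) * ((k * d + n).choose n : ℤ) := by
    intro k
    rw [← hpos]
    simp only [P, Polynomial.eval_comp]
    congr 1
    simp
    ring
  have hf : (n.factorial : ℤ) ≠ 0 := by exact_mod_cast n.factorial_ne_zero
  have hs : ((-1 : ℤ) ^ n) * (-1) ^ n = 1 := by rw [← mul_pow]; simp
  have hsum : ∑ i ∈ Finset.Icc 1 n,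
          (-1 : ℤ) ^ (n - i) * ((n + 1).choose (i + 1)) * ((i * d - d + n).choose n)
      = ∑ k ∈ Finset.range n, (-1 : ℤ) ^ (n + 1 - (k + 1 + 1)) * ((n + 1).choose (k + 1 + 1))
          * ((k * d + n).choose n) := by
    rw [← Finset.Ico_add_one_right_eq_Icc, Finset.sum_Ico_eq_sum_range]
    refine Finset.sum_congr (by simp) fun k _ => ?_
    have a : n - (1 + k) = n + 1 - (k + 1 + 1) := by omega
    have b : (1 + k) * d - d = k * d := by rw [add_mul, one_mul]; omega
    rw [a, b, add_comm 1 k]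
  rw [hsum]
  apply mul_left_cancel₀ hf
  rw [Finset.mul_sum]
  have hk : ∀ k ∈ Finset.range n, (n.factorial : ℤ) *
      ((-1 : ℤ) ^ (n + 1 - (k + 1 + 1)) * ((n + 1).choose (k + 1 + 1)) * ((k * d + n).choose n))
      = ((-1 : ℤ) ^ (n + 1 - (k + 1 + 1)) * ((n + 1).choose (k + 1 + 1))) •
        P.eval (0 + (k + 1 + 1) • 1) := by
    intro k _
    have : (0 + (k + 1 + 1) • 1 : ℤ) = (k : ℤ) + 2 := by simp; ring
    rw [this, e2, smul_eq_mul]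
    ring
  rw [Finset.sum_congr rfl hk]
  simp only [zero_add, zero_smul, one_smul, e0, e1, smul_eq_mul, Nat.sub_zero, Nat.choose_zero_right,
    Nat.choose_one_right, Nat.add_sub_cancel, Pi.zero_apply, pow_succ (-1 : ℤ) n] at key ⊢
  push_cast at key ⊢
  linear_combination (-1) * key + (-(n.factorial : ℤ) * ((2 * d - 1).choose n : ℤ)
    + (n + 1) * (n.factorial : ℤ) * ((d - 1).choose n : ℤ)) * hs
end

section
/- Fix integers n ≥ 4 and d ≥ n + 2. Define φ : ℕ → ℤ recursively by φ(0) = 1 and, for h ≥ 1, φ(h) = C(n + h·d, n) − Σ_{j=1}^{h} Σ_{i=1}^{d−n−1} C(j·d − j + h − i, n−1) − Σ_{l=0}^{h−1} φ(l), where C(·,·) denotes the binomial coefficient. Then Σ_{h=0}^{n−1} (−1)^{n−1−h} · C(n, h+1) · φ(h) = C(d+n, n) − C(d, n). -/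
open Polynomial in
lemma aux_faul (r : ℕ) : ∃ s : ℚ[X], s.natDegree ≤ r + 1 ∧
    (∀ x : ℚ, s.eval x = s.eval (x - 1) + x ^ r) ∧ s.eval (-1) = 0 := by
  refine ⟨C ((r + 1 : ℚ)⁻¹) *
    ((Polynomial.bernoulli (r + 1)).comp (X + C 1) - C ((Polynomial.bernoulli (r + 1)).eval 0)),
    ?_, ?_, ?_⟩
  · have hb : (Polynomial.bernoulli (r + 1)).natDegree ≤ r + 1 := by
      rw [Polynomial.bernoulli_def]
      apply natDegree_sum_le_of_forall_le
      intro i hi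
      refine (natDegree_monomial_le _).trans ?_
      have := Finset.mem_range.1 hi
      omega
    refine (natDegree_C_mul_le _ _).trans ((natDegree_sub_C).le.trans ?_)
    refine natDegree_comp_le.trans ?_
    rw [natDegree_X_add_C]; omega
  · intro x
    have h1 := Polynomial.bernoulli_eval_one_add (r + 1) x
    have h2 : ((r : ℚ) + 1) ≠ 0 := by positivity
    simp only [eval_mul, eval_C, eval_sub, eval_comp, eval_add, eval_X]
    rw [add_comm x 1, h1]
    simp only [Nat.add_sub_cancel, sub_add_cancel]
    push_cast
    field_simp
    ring
  · simp

open Polynomial in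
lemma aux_mono (e : ℚ) (m : ℕ) : ∃ Q : ℚ[X], Q.natDegree ≤ m + 1 ∧
    (∀ h : ℕ, Q.eval (h : ℚ) = ∑ j ∈ Finset.range (h + 1), ((j : ℚ) * e + h) ^ m) ∧
    Q.eval (-1) = 0 ∧ Q.eval (-2) = - (-e - 2) ^ m := by
  choose s hs1 hs2 hs3 using aux_faul
  have hs4 : ∀ r (h : ℕ), (s r).eval (h : ℚ) = ∑ j ∈ Finset.range (h + 1), (j : ℚ) ^ r := by
    intro r h
    induction h with
    | zero => rw [hs2]; simp [hs3]
    | succ h ih => rw [Finset.sum_range_succ, ← ih, hs2]; simp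
  have hs5 : ∀ r, (s r).eval (-2) = - (-1) ^ r := by
    intro r
    have := hs2 r (-1)
    rw [hs3] at this
    norm_num at this
    linarith
  refine ⟨∑ r ∈ Finset.range (m + 1), C ((m.choose r : ℚ) * e ^ r) * (s r * X ^ (m - r)),
    ?_, ?_, ?_, ?_⟩
  · apply natDegree_sum_le_of_forall_le
    intro r hr
    have := Finset.mem_range.1 hr
    refine (natDegree_C_mul_le _ _).trans (natDegree_mul_le.trans ?_)
    rw [natDegree_X_pow]
    have := hs1 r
    omega
  · intro h
    simp only [eval_finsetSum, eval_mul, eval_C, eval_pow, eval_X, hs4, add_pow]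
    rw [Finset.sum_comm]
    refine Finset.sum_congr rfl fun r _ => ?_
    rw [Finset.sum_mul, Finset.mul_sum]
    refine Finset.sum_congr rfl fun j _ => ?_
    rw [mul_pow]; ring
  · simp [eval_finsetSum, hs3]
  · simp only [eval_finsetSum, eval_mul, eval_C, eval_pow, eval_X, hs5]
    rw [sub_eq_add_neg, add_pow, ← Finset.sum_neg_distrib]
    refine Finset.sum_congr rfl fun r _ => ?_
    rw [neg_pow e]; ring

open Polynomial in
lemma aux_poly (e : ℚ) (P : ℚ[X]) : ∃ Q : ℚ[X], Q.natDegree ≤ P.natDegree + 1 ∧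
    (∀ h : ℕ, Q.eval (h : ℚ) = ∑ j ∈ Finset.range (h + 1), P.eval ((j : ℚ) * e + h)) ∧
    Q.eval (-1) = 0 ∧ Q.eval (-2) = - P.eval (-e - 2) := by
  choose q h1 h2 h3 h4 using aux_mono e
  refine ⟨∑ k ∈ Finset.range (P.natDegree + 1), C (P.coeff k) * q k, ?_, ?_, ?_, ?_⟩
  · apply natDegree_sum_le_of_forall_le
    intro r hr
    have := Finset.mem_range.1 hr
    refine (natDegree_C_mul_le _ _).trans ((h1 r).trans (by omega))
  · intro h
    simp only [eval_finsetSum, eval_mul, eval_C, h2, eval_eq_sum_range (p := P)]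
    rw [Finset.sum_comm]
    simp only [Finset.mul_sum]
  · simp [eval_finsetSum, h3]
  · simp [eval_finsetSum, h4, eval_eq_sum_range (p := P)]

open Polynomial in
lemma aux_desc_neg (n : ℕ) (x : ℚ) : (descPochhammer ℚ n).eval (-x) =
    (-1) ^ n * (descPochhammer ℚ n).eval (x + n - 1) := by
  rw [descPochhammer_eval_eq_prod_range, descPochhammer_eval_eq_prod_range,
    ← Finset.prod_range_reflect (fun j : ℕ => x + n - 1 - (j : ℚ)),
    ← Finset.card_range n, ← Finset.prod_const, Finset.card_range, ← Finset.prod_mul_distrib]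
  refine Finset.prod_congr rfl fun i hi => ?_
  have := Finset.mem_range.1 hi
  rw [Nat.cast_sub (by omega), Nat.cast_sub (by omega)]
  push_cast; ring

open Polynomial in
lemma aux_P (n d : ℕ) (hn : 1 ≤ n) : ∃ P : ℚ[X], P.natDegree + 1 ≤ n ∧
    (∀ x : ℕ, P.eval (x : ℚ) = ((x + n).choose n : ℚ) - (x.choose n : ℚ)) ∧
    P.eval (-(d : ℚ) - 1) = (-1) ^ n * ((d.choose n : ℚ) - ((d + n).choose n : ℚ)) := by
  refine ⟨C ((n.factorial : ℚ)⁻¹) * ((descPochhammer ℚ n).comp (X + C (n : ℚ)) -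
    descPochhammer ℚ n), ?_, ?_, ?_⟩
  · have m1 := monic_descPochhammer ℚ n
    have m2 : ((descPochhammer ℚ n).comp (X + C (n : ℚ))).Monic := m1.comp_X_add_C _
    have d1 : (descPochhammer ℚ n).natDegree = n := descPochhammer_natDegree ℚ n
    have d2 : ((descPochhammer ℚ n).comp (X + C (n : ℚ))).natDegree = n := by
      rw [natDegree_comp, natDegree_X_add_C, d1, mul_one]
    have : ((descPochhammer ℚ n).comp (X + C (n : ℚ)) - descPochhammer ℚ n).natDegree < n := by
      have h := degree_sub_lt_left (p := (descPochhammer ℚ n).comp (X + C (n : ℚ)))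
        (q := descPochhammer ℚ n)
        (by rw [degree_eq_natDegree m1.ne_zero, degree_eq_natDegree m2.ne_zero, d1, d2])
        m2.ne_zero (by rw [m1.leadingCoeff, m2.leadingCoeff])
      rw [degree_eq_natDegree m2.ne_zero, d2] at h
      by_cases hz : (descPochhammer ℚ n).comp (X + C (n : ℚ)) - descPochhammer ℚ n = 0
      · rw [hz, natDegree_zero]; omega
      · exact (natDegree_lt_iff_degree_lt hz).2 h
    have h2 := natDegree_C_mul_le ((n.factorial : ℚ)⁻¹)
      ((descPochhammer ℚ n).comp (X + C (n : ℚ)) - descPochhammer ℚ n)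
    omega
  · intro x
    rw [Nat.cast_choose_eq_descPochhammer_div, Nat.cast_choose_eq_descPochhammer_div]
    simp [eval_comp]
    ring
  · rw [Nat.cast_choose_eq_descPochhammer_div, Nat.cast_choose_eq_descPochhammer_div]
    have h1 := aux_desc_neg n (d + 1 - n)
    have h2 := aux_desc_neg n (d + 1)
    rw [show (d : ℚ) + 1 - n + n - 1 = d by ring,
      show -((d : ℚ) + 1 - n) = -(d : ℚ) - 1 + n by ring] at h1
    rw [show (d : ℚ) + 1 + n - 1 = d + n by ring,
      show -((d : ℚ) + 1) = -(d : ℚ) - 1 by ring] at h2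
    simp only [eval_mul, eval_C, eval_sub, eval_comp, eval_add, eval_X]
    rw [h1, h2]
    push_cast
    ring

lemma aux_abel (n : ℕ) (φ : ℕ → ℤ) (N : ℕ) :
    ∑ h ∈ Finset.range N, (-1 : ℤ) ^ h * ((n + 1).choose (h + 2)) * ∑ l ∈ Finset.range (h + 1), φ l
    = ∑ h ∈ Finset.range N, (-1 : ℤ) ^ h * (n.choose (h + 1)) * φ h
      - (-1) ^ N * (n.choose (N + 1)) * ∑ l ∈ Finset.range N, φ l := by
  induction N with
  | zero => simp
  | succ N ih =>
    rw [Finset.sum_range_succ, ih, Finset.sum_range_succ (fun h => (-1 : ℤ) ^ h * _ * φ h),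
      Finset.sum_range_succ φ, Nat.choose_succ_succ]
    push_cast
    ring

lemma aux_tele (k N m : ℕ) (hm : m ≤ N) :
    ∑ i ∈ Finset.Icc 1 m, ((N - i).choose k : ℤ) = (N.choose (k + 1) : ℤ) - (N - m).choose (k + 1) := by
  induction m with
  | zero => simp
  | succ m ih =>
    rw [Finset.sum_Icc_succ_top (by omega), ih (by omega)]
    have : N - m = (N - (m + 1)) + 1 := by omega
    rw [this, Nat.choose_succ_succ]
    push_cast
    ring

/-- Lemma (lem:h11st): the alternating sum of the recursively defined lattice-point
counting function `φ = φ_{a₀}` equals `C(d+n, n) - C(d, n)`. -/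
theorem stringy_h11_eq
    (n d : ℕ) (hn : 4 ≤ n) (hd : n + 2 ≤ d) (φ : ℕ → ℤ)
    (h0 : φ 0 = 1)
    (hrec : ∀ h : ℕ, 1 ≤ h → φ h = ((n + h * d).choose n : ℤ)
      - ∑ j ∈ Finset.Icc 1 h, ∑ i ∈ Finset.Icc 1 (d - n - 1),
          ((j * d - j + h - i).choose (n - 1) : ℤ)
      - ∑ l ∈ Finset.range h, φ l) :
    ∑ h ∈ Finset.range n, (-1 : ℤ) ^ (n - 1 - h) * (n.choose (h + 1)) * φ h
      = ((d + n).choose n : ℤ) - (d.choose n) := by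
  obtain ⟨e, rfl⟩ : ∃ e, d = e + 1 := ⟨d - 1, by omega⟩
  have hΦ : ∀ h < n, ∑ l ∈ Finset.range (h + 1), φ l =
      ∑ j ∈ Finset.range (h + 1),
        (((j * e + h + n).choose n : ℤ) - ((j * e + h).choose n : ℤ)) := by
    intro h hh
    rcases Nat.eq_zero_or_pos h with rfl | hpos
    · simp [h0, Nat.choose_eq_zero_of_lt hh]
    rw [Finset.sum_range_succ, hrec h hpos]
    have key : ∀ j ∈ Finset.Icc 1 h, ∑ i ∈ Finset.Icc 1 (e + 1 - n - 1),
        ((j * (e + 1) - j + h - i).choose (n - 1) : ℤ) =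
        ((j * e + h).choose n : ℤ) - (((j - 1) * e + h + n).choose n : ℤ) := by
      intro j hj
      obtain ⟨j, rfl⟩ : ∃ i, j = i + 1 := ⟨j - 1, by have := (Finset.mem_Icc.1 hj).1; omega⟩
      have e1 : (j + 1) * (e + 1) - (j + 1) + h = (j + 1) * e + h := by
        rw [mul_add_one, Nat.add_sub_cancel]
      have e2 : (j + 1) * e = j * e + e := by ring
      rw [e1, aux_tele _ _ _ (by rw [e2]; omega), Nat.sub_add_cancel (by omega : 1 ≤ n)]
      congr 3
      rw [e2, Nat.add_sub_cancel]; omega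
    rw [Finset.sum_congr rfl key, Finset.sum_sub_distrib, Finset.sum_sub_distrib]
    have s1 : ∑ j ∈ Finset.Icc 1 h, ((j * e + h).choose n : ℤ) =
        ∑ j ∈ Finset.range (h + 1), ((j * e + h).choose n : ℤ) := by
      rw [Finset.sum_range_succ', Finset.range_eq_Ico, Finset.sum_Ico_add' 
        (fun j => ((j * e + h).choose n : ℤ)) 0 h 1]
      simp [Nat.choose_eq_zero_of_lt hh]
      rfl
    have s2 : ∑ j ∈ Finset.Icc 1 h, (((j - 1) * e + h + n).choose n : ℤ) =
        ∑ j ∈ Finset.range h, ((j * e + h + n).choose n : ℤ) := by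
      have := Finset.sum_Ico_add' (fun j => (((j - 1) * e + h + n).choose n : ℤ)) 0 h 1
      rw [Finset.range_eq_Ico]
      simp only [Nat.add_sub_cancel] at this
      rw [this]
      rfl
    rw [s1, s2, Finset.sum_range_succ (fun j => ((j * e + h + n).choose n : ℤ))]
    rw [show n + h * (e + 1) = h * e + h + n by ring]
    ring
  obtain ⟨P, hP1, hP2, hP3⟩ := aux_P n (e + 1) (by omega)
  obtain ⟨Q, hQ1, hQ2, hQ3, hQ4⟩ := aux_poly (e : ℚ) P
  have hQΦ : ∀ h < n, Q.eval (h : ℚ) = ((∑ l ∈ Finset.range (h + 1), φ l : ℤ) : ℚ) := by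
    intro h hh
    rw [hΦ h hh, hQ2]
    push_cast
    refine Finset.sum_congr rfl fun j _ => ?_
    have := hP2 (j * e + h)
    push_cast at this
    exact this
  have hz := congrFun (Polynomial.fwdDiff_iter_eq_zero_of_degree_lt
    (P := Q) (n := n + 1) (by omega)) (-2)
  rw [fwdDiff_iter_eq_sum_shift, Finset.sum_range_succ', Finset.sum_range_succ'] at hz
  have sgn : ∀ h < n, (-1 : ℤ) ^ (n - 1 - h) = (-1) ^ (n - 1) * (-1) ^ h := by
    intro h hh
    have : n - 1 = (n - 1 - h) + h := by omega
    conv_rhs => rw [this, pow_add, mul_assoc, ← pow_add, ← two_mul, pow_mul]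
    simp
  have habel := aux_abel n φ n
  rw [Nat.choose_eq_zero_of_lt (Nat.lt_succ_self n)] at habel
  have hS : ∑ h ∈ Finset.range n, (-1 : ℤ) ^ (n - 1 - h) * (n.choose (h + 1)) * φ h =
      ∑ h ∈ Finset.range n, (-1 : ℤ) ^ (n - 1 - h) * ((n + 1).choose (h + 2)) *
        ∑ l ∈ Finset.range (h + 1), φ l := by
    have t : ∀ (c f : ℕ → ℤ), ∑ h ∈ Finset.range n, (-1 : ℤ) ^ (n - 1 - h) * c h * f h =
        (-1) ^ (n - 1) * ∑ h ∈ Finset.range n, (-1 : ℤ) ^ h * c h * f h := by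
      intro c f
      rw [Finset.mul_sum]
      refine Finset.sum_congr rfl fun h hh => ?_
      rw [sgn h (Finset.mem_range.1 hh)]; ring
    rw [t (fun h => (n.choose (h + 1) : ℤ)), 
      t (fun h => ((n + 1).choose (h + 2) : ℤ)) (fun h => ∑ l ∈ Finset.range (h + 1), φ l), habel]
    simp
  rw [hS]
  have hz2 : ∑ k ∈ Finset.range n, ((-1 : ℤ) ^ (n + 1 - (k + 1 + 1)) *
      ((n + 1).choose (k + 1 + 1) : ℤ)) • Q.eval ((-2 : ℚ) + (k + 1 + 1) • (1 : ℚ)) =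
      ((∑ h ∈ Finset.range n, (-1 : ℤ) ^ (n - 1 - h) * ((n + 1).choose (h + 2)) *
        ∑ l ∈ Finset.range (h + 1), φ l : ℤ) : ℚ) := by
    rw [Int.cast_sum]
    refine Finset.sum_congr rfl fun h hh => ?_
    rw [show (-2 : ℚ) + (h + 1 + 1) • (1 : ℚ) = (h : ℚ) by simp; ring,
      hQΦ h (Finset.mem_range.1 hh), show n + 1 - (h + 1 + 1) = n - 1 - h by omega]
    simp
  rw [hz2] at hz
  have a1 : (-2 : ℚ) + (0 + 1) • (1 : ℚ) = -1 := by norm_num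
  have a2 : (-2 : ℚ) + 0 • (1 : ℚ) = -2 := by norm_num
  rw [a1, a2, hQ3, hQ4, show -(e : ℚ) - 2 = -((e + 1 : ℕ) : ℚ) - 1 by push_cast; ring, hP3] at hz
  have sq : ((-1 : ℚ) ^ n) * (-1) ^ n = 1 := by rw [← mul_pow]; norm_num
  have : ((∑ h ∈ Finset.range n, (-1 : ℤ) ^ (n - 1 - h) * ((n + 1).choose (h + 2)) *
        ∑ l ∈ Finset.range (h + 1), φ l : ℤ) : ℚ) =
      (((e + 1 + n).choose n : ℤ) - ((e + 1).choose n : ℤ) : ℤ) := by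
    simp only [smul_zero, add_zero, Nat.sub_zero, Nat.choose_zero_right, zsmul_eq_mul,
      Pi.zero_apply, pow_succ] at hz
    push_cast at hz ⊢
    linear_combination hz - (((e + 1).choose n : ℚ) - ((e + 1 + n).choose n : ℚ)) * sq
  exact_mod_cast this
end

section
/- Fix an integer n ≥ 4. Define φ : ℕ → ℤ recursively by φ(0) = 1 and, for h ≥ 1, φ(h) = C(h(n+2) + n, n) − Σ_{j=0}^{h−1} ( C((j+1)(n+1) + h − 1, n−1) + φ(j) ), where C(·,·) denotes the binomial coefficient. Then −C(n+1, 2) + Σ_{h=0}^{n−1} (−1)^{n−1−h} · C(n, h+1) · φ(h) = C(2n+2, n) − (n+1)². -/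
open Polynomial in
/-- the binomial polynomial -/
noncomputable def bp (m : ℕ) : Polynomial ℚ := C ((m.factorial : ℚ)⁻¹) * descPochhammer ℚ m

lemma bp_nat (m a : ℕ) : (bp m).eval (a : ℚ) = (a.choose m : ℚ) := by
  rw [bp, Polynomial.eval_mul, Polynomial.eval_C, Nat.cast_choose_eq_descPochhammer_div]
  field_simp

lemma bp_neg (m a : ℕ) : (bp m).eval (-((a : ℚ) + 1)) = (-1) ^ m * ((a + m).choose m : ℚ) := by
  have h := ascPochhammer_eval_neg_eq_descPochhammer ℚ (-((a : ℚ) + 1)) m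
  have h2 : (ascPochhammer ℚ m).eval ((a : ℚ) + 1) = m.factorial * ((a + m).choose m : ℚ) := by
    have := ascPochhammer_nat_eq_ascFactorial (a + 1) m
    have h3 := Nat.ascFactorial_eq_factorial_mul_choose a m
    rw [h3] at this
    rw [← Nat.cast_succ, ← ascPochhammer_eval_cast, Nat.succ_eq_add_one, this]
    push_cast
    ring
  rw [neg_neg, h2] at h
  have h4 : (descPochhammer ℚ m).eval (-((a : ℚ) + 1))
      = (-1) ^ m * (m.factorial * ((a + m).choose m : ℚ)) := by
    rw [h, ← mul_assoc, ← mul_pow]; simp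
  rw [bp, Polynomial.eval_mul, Polynomial.eval_C, h4]
  have : (m.factorial : ℚ) ≠ 0 := by positivity
  field_simp

lemma bp_deg (m : ℕ) : (bp m).natDegree ≤ m := by
  unfold bp
  refine (Polynomial.natDegree_C_mul_le _ _).trans ?_
  rw [descPochhammer_natDegree]

/-- polynomial summability of a bivariate function along the triangle -/
def GoodB (d : ℕ) (p : ℚ → ℚ → ℚ) : Prop :=
  ∃ B : Polynomial ℚ, B.natDegree ≤ d + 1 ∧
    (∀ h : ℕ, B.eval (h : ℚ) = ∑ j ∈ Finset.range h, p ((j : ℚ) + 1) h) ∧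
    B.eval (-1) = - p 0 (-1) ∧ B.eval (-2) = - p 0 (-2) - p (-1) (-2)

lemma GoodB.sum {d : ℕ} {ι : Type} (s : Finset ι) (c : ι → ℚ) (p : ι → ℚ → ℚ → ℚ)
    (hp : ∀ i ∈ s, GoodB d (p i)) : GoodB d (fun x y => ∑ i ∈ s, c i * p i x y) := by
  classical
  choose! B h1 h2 h3 h4 using hp
  refine ⟨∑ i ∈ s, Polynomial.C (c i) * B i, ?_, ?_, ?_, ?_⟩
  · exact Polynomial.natDegree_sum_le_of_forall_le _ _
      fun i hi => (Polynomial.natDegree_C_mul_le _ _).trans (h1 i hi)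
  · intro h
    simp only [Polynomial.eval_finsetSum, Polynomial.eval_mul, Polynomial.eval_C]
    rw [Finset.sum_comm]
    refine Finset.sum_congr rfl fun i hi => ?_
    rw [h2 i hi, Finset.mul_sum]
  · simp only [Polynomial.eval_finsetSum, Polynomial.eval_mul, Polynomial.eval_C]
    rw [← Finset.sum_neg_distrib]
    refine Finset.sum_congr rfl fun i hi => ?_
    rw [h3 i hi]; ring
  · simp only [Polynomial.eval_finsetSum, Polynomial.eval_mul, Polynomial.eval_C]
    rw [← Finset.sum_neg_distrib, ← Finset.sum_sub_distrib]
    refine Finset.sum_congr rfl fun i hi => ?_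
    rw [h4 i hi]; ring

lemma faul (a : ℕ) : ∃ Q : Polynomial ℚ, Q.natDegree ≤ a + 1 ∧ Q.eval 0 = 0 ∧
    ∀ x : ℚ, Q.eval (x + 1) = Q.eval x + (x + 1) ^ a := by
  refine ⟨Polynomial.C ((a + 1 : ℚ)⁻¹) * ((Polynomial.bernoulli (a + 1)).comp
    (Polynomial.X + Polynomial.C 1) - Polynomial.C ((Polynomial.bernoulli (a + 1)).eval 1)),
    ?_, ?_, ?_⟩
  · refine (Polynomial.natDegree_C_mul_le _ _).trans ?_
    rw [Polynomial.natDegree_sub_C, Polynomial.natDegree_comp, Polynomial.natDegree_X_add_C,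
      mul_one, Polynomial.natDegree_le_iff_coeff_eq_zero]
    intro N hN
    rw [Polynomial.coeff_bernoulli, if_neg (by omega)]
  · simp
  · intro x
    have := Polynomial.bernoulli_eval_one_add (a + 1) (x + 1)
    have e : x + 1 + 1 = 1 + (x + 1) := by ring
    simp only [Polynomial.eval_mul, Polynomial.eval_C, Polynomial.eval_sub, Polynomial.eval_comp,
      Polynomial.eval_add, Polynomial.eval_X]
    rw [e, this]
    have h : (a + 1 : ℚ) ≠ 0 := by positivity
    push_cast
    field_simp
    simp
    ring

lemma GoodB.mono {d a b : ℕ} (h : a + b ≤ d) : GoodB d (fun x y => x ^ a * y ^ b) := by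
  obtain ⟨Q, h1, h2, h3⟩ := faul a
  have e1 : Q.eval (-1) = - 0 ^ a := by
    have := h3 (-1)
    norm_num [h2] at this
    linarith
  refine ⟨Q * Polynomial.X ^ b, ?_, ?_, ?_, ?_⟩
  · refine Polynomial.natDegree_mul_le.trans ?_
    rw [Polynomial.natDegree_X_pow]; omega
  · intro h
    rw [Polynomial.eval_mul, Polynomial.eval_pow, Polynomial.eval_X, ← Finset.sum_mul]
    congr 1
    induction h with
    | zero => simpa using h2
    | succ k ih => rw [Finset.sum_range_succ, ← ih]; push_cast; exact h3 _
  · simp [e1]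
  · have := h3 (-2)
    norm_num [e1] at this
    have e2 : Q.eval (-2) = - 0 ^ a - (-1) ^ a := by linarith
    simp [e2]; ring

lemma GoodB.lin {d : ℕ} (c : ℚ) (r : Polynomial ℚ) (hr : r.natDegree ≤ d) :
    GoodB d (fun x y => r.eval (c * x + y)) := by
  have : (fun x y : ℚ => r.eval (c * x + y)) = fun x y => ∑ k ∈ Finset.range (d + 1),
      r.coeff k * (fun x y : ℚ => ∑ m ∈ Finset.range (k + 1),
        (c ^ m * (k.choose m : ℚ)) * (fun x y : ℚ => x ^ m * y ^ (k - m)) x y) x y := by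
    funext x y
    rw [Polynomial.eval_eq_sum_range' (Nat.lt_succ_of_le hr)]
    refine Finset.sum_congr rfl fun k _ => ?_
    rw [add_pow]
    congr 1
    refine Finset.sum_congr rfl fun m _ => ?_
    rw [mul_pow]; ring
  rw [this]
  refine GoodB.sum _ _ (fun k x y => ∑ m ∈ Finset.range (k + 1),
        (c ^ m * (k.choose m : ℚ)) * (fun x y : ℚ => x ^ m * y ^ (k - m)) x y) fun k hk => ?_
  refine GoodB.sum _ _ (fun m x y => x ^ m * y ^ (k - m)) fun m hm => ?_
  rw [Finset.mem_range] at hk hm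
  exact GoodB.mono (by omega)

lemma abel_sum (n : ℕ) (φ : ℕ → ℤ) (m : ℕ) :
    ∑ h ∈ Finset.range m, (-1 : ℤ) ^ h * ((n + 1).choose (h + 2)) *
        (∑ j ∈ Finset.range (h + 1), φ j)
      = ∑ h ∈ Finset.range m, (-1 : ℤ) ^ h * (n.choose (h + 1)) * φ h
        - (-1) ^ m * (n.choose (m + 1)) * ∑ j ∈ Finset.range m, φ j := by
  induction m with
  | zero => simp
  | succ m ih =>
    rw [Finset.sum_range_succ, ih, Finset.sum_range_succ _ m, Finset.sum_range_succ _ m,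
      Nat.choose_succ_succ n (m + 1)]
    push_cast
    ring

lemma poly_S (d : ℕ) : ∃ P : Polynomial ℚ, P.natDegree ≤ d + 1 ∧
    (∀ h : ℕ, P.eval (h : ℚ) = ((h * (d + 3) + (d + 1)).choose (d + 1) : ℚ)
      - ∑ j ∈ Finset.range h, (((j + 1) * (d + 2) + h - 1).choose d : ℚ)) ∧
    P.eval (-1) = (-1) ^ (d + 1) * (d + 2) + (-1) ^ d * (d + 1) ∧
    P.eval (-2) = (-1) ^ (d + 1) * ((2 * d + 5).choose (d + 1) : ℚ)
      + (-1) ^ d * ((d + 2).choose 2 + (2 * d + 4).choose d : ℚ) := by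
  obtain ⟨B, b1, b2, b3, b4⟩ := GoodB.lin (d := d) (d + 2 : ℚ)
    ((bp d).comp (Polynomial.X - Polynomial.C 1))
    (by rw [Polynomial.natDegree_comp, Polynomial.natDegree_X_sub_C, mul_one]; exact bp_deg d)
  simp only [Polynomial.eval_comp, Polynomial.eval_sub, Polynomial.eval_X,
    Polynomial.eval_C] at b2 b3 b4
  refine ⟨(bp (d + 1)).comp (Polynomial.C (d + 3 : ℚ) * Polynomial.X + Polynomial.C (d + 1 : ℚ))
    - B, ?_, ?_, ?_, ?_⟩
  · refine (Polynomial.natDegree_sub_le _ _).trans (max_le ?_ b1)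
    refine Polynomial.natDegree_comp_le.trans ?_
    calc _ ≤ (d + 1) * 1 := Nat.mul_le_mul (bp_deg _) Polynomial.natDegree_linear_le
      _ = d + 1 := by ring
  · intro h
    rw [Polynomial.eval_sub, b2]
    congr 1
    · rw [← bp_nat]; simp; ring_nf
    · refine Finset.sum_congr rfl fun j _ => ?_
      rw [← bp_nat, Nat.cast_sub (by nlinarith)]
      push_cast; ring_nf
  · rw [Polynomial.eval_sub, b3]
    have e1 := bp_neg (d + 1) 1
    have e2 := bp_neg d 1
    rw [show (d + 2 : ℚ) * 0 + -1 - 1 = -((1 : ℕ) + 1 : ℚ) by push_cast; ring, e2]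
    simp only [Polynomial.eval_comp, Polynomial.eval_add, Polynomial.eval_mul, Polynomial.eval_X,
      Polynomial.eval_C]
    rw [show (d + 3 : ℚ) * -1 + (d + 1) = -((1 : ℕ) + 1 : ℚ) by push_cast; ring, e1]
    rw [add_comm 1 d, add_comm 1 (d + 1), Nat.choose_succ_self_right, Nat.choose_succ_self_right]
    push_cast; ring
  · rw [Polynomial.eval_sub, b4]
    have e1 := bp_neg (d + 1) (d + 4)
    have e2 := bp_neg d 2
    have e3 := bp_neg d (d + 4)
    rw [show (d + 2 : ℚ) * 0 + -2 - 1 = -((2 : ℕ) + 1 : ℚ) by push_cast; ring, e2,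
      show (d + 2 : ℚ) * -1 + -2 - 1 = -((d + 4 : ℕ) + 1 : ℚ) by push_cast; ring, e3]
    simp only [Polynomial.eval_comp, Polynomial.eval_add, Polynomial.eval_mul, Polynomial.eval_X,
      Polynomial.eval_C]
    rw [show (d + 3 : ℚ) * -2 + (d + 1) = -((d + 4 : ℕ) + 1 : ℚ) by push_cast; ring, e1]
    rw [add_comm 2 d, Nat.choose_symm_add, show d + 4 + (d + 1) = 2 * d + 5 by ring,
      show d + 4 + d = 2 * d + 4 by ring]
    ring

/-- Numerical identity underlying Theorem (thm:B-mirror1) for degree `d = n + 2`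
hypersurfaces: `k_{Ŷ∨} = -C(n+1,2) + c'₁ = C(2n+2, n) - (n+1)² = m_Y`. -/
theorem kahler_moduli_eq_complex_moduli_deg_n_plus_two
    (n : ℕ) (hn : 4 ≤ n) (φ : ℕ → ℤ)
    (h0 : φ 0 = 1)
    (hrec : ∀ h : ℕ, 1 ≤ h → φ h = ((h * (n + 2) + n).choose n : ℤ)
      - ∑ j ∈ Finset.range h,
          ((((j + 1) * (n + 1) + h - 1).choose (n - 1) : ℤ) + φ j)) :
    -(((n + 1).choose 2 : ℤ))
      + ∑ h ∈ Finset.range n, (-1 : ℤ) ^ (n - 1 - h) * (n.choose (h + 1)) * φ h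
      = ((2 * n + 2).choose n : ℤ) - (n + 1) ^ 2 := by
  obtain ⟨d, rfl⟩ : ∃ d, n = d + 1 := ⟨n - 1, by omega⟩
  obtain ⟨P, p1, p2, p3, p4⟩ := poly_S d
  have hS : ∀ h : ℕ, P.eval (h : ℚ) = ((∑ j ∈ Finset.range (h + 1), φ j : ℤ) : ℚ) := by
    intro h
    rw [p2]
    rcases Nat.eq_zero_or_pos h with rfl | hh
    · simp [h0]
    · rw [Finset.sum_range_succ, hrec h hh, Finset.sum_add_distrib]
      push_cast
      ring_nf
  have hD := congrFun (Polynomial.fwdDiff_iter_eq_zero_of_degree_lt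
    (P := P) (n := d + 2) (by omega)) (-2)
  rw [fwdDiff_iter_eq_sum_shift, Finset.sum_range_succ', Finset.sum_range_succ'] at hD
  have hA := abel_sum (d + 1) φ (d + 1)
  rw [Nat.choose_succ_self] at hA
  have hsgn : ∀ h ∈ Finset.range (d + 1), (-1 : ℤ) ^ (d - h) = (-1) ^ d * (-1) ^ h := by
    intro h hh
    rw [Finset.mem_range] at hh
    obtain ⟨k, rfl⟩ := Nat.exists_eq_add_of_le (Nat.lt_succ_iff.mp hh)
    rw [Nat.add_sub_cancel_left, pow_add, mul_right_comm, ← mul_pow]; simp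
  have hL : ∑ h ∈ Finset.range (d + 1), (-1 : ℤ) ^ (d + 1 - 1 - h) * ((d + 1).choose (h + 1)) * φ h
      = (-1) ^ d * ∑ h ∈ Finset.range (d + 1), (-1 : ℤ) ^ h * ((d + 1 + 1).choose (h + 2)) *
        (∑ j ∈ Finset.range (h + 1), φ j) := by
    rw [hA]
    simp only [Nat.cast_zero, mul_zero, zero_mul, sub_zero]
    rw [Finset.mul_sum]
    refine Finset.sum_congr rfl fun h hh => ?_
    rw [Nat.add_sub_cancel, hsgn h hh]; ring
  have hE : ∑ k ∈ Finset.range (d + 1),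
      ((-1 : ℤ) ^ (d + 2 - (k + 1 + 1)) * ((d + 2).choose (k + 1 + 1) : ℤ)) •
        P.eval (-2 + (k + 1 + 1) • (1 : ℚ)) =
      (((-1) ^ d * ∑ h ∈ Finset.range (d + 1), (-1 : ℤ) ^ h * ((d + 1 + 1).choose (h + 2)) *
        (∑ j ∈ Finset.range (h + 1), φ j) : ℤ) : ℚ) := by
    rw [Finset.mul_sum, Int.cast_sum]
    refine Finset.sum_congr rfl fun h hh => ?_
    rw [show (-2 + (h + 1 + 1) • (1 : ℚ)) = (h : ℚ) by simp; ring, hS,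
      show d + 2 - (h + 1 + 1) = d - h by omega, hsgn h hh, zsmul_eq_mul]
    push_cast; ring
  rw [hE, ← hL] at hD
  generalize (∑ h ∈ Finset.range (d + 1), (-1 : ℤ) ^ (d + 1 - 1 - h) *
    ((d + 1).choose (h + 1)) * φ h) = T at hD ⊢
  have e1 : (-2 + (0 + 1) • (1 : ℚ)) = -1 := by norm_num
  have e2 : (-2 + 0 • (1 : ℚ)) = -2 := by norm_num
  rw [e1, e2, p3, p4] at hD
  have hs : ((-1 : ℚ) ^ d) * (-1) ^ d = 1 := by rw [← mul_pow]; simp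
  have hc2 : ((d + 2).choose 2 : ℚ) = (d + 2) * (d + 1) / 2 := by
    rw [Nat.cast_choose_two]; push_cast; ring
  have hp : ((2 * d + 5).choose (d + 1) : ℚ)
      = (2 * d + 4).choose d + (2 * d + 4).choose (d + 1) := by
    rw [Nat.choose_succ_succ]; push_cast; rfl
  have e3 : d + 2 - (0 + 1) = d + 1 := by omega
  simp only [zsmul_eq_mul, Pi.zero_apply, e3, Nat.sub_zero, Nat.choose_zero_right, zero_add,
    Nat.choose_one_right] at hD
  push_cast at hD
  rw [hp, hc2] at hD
  have goalQ : -(((d + 2).choose 2 : ℚ)) + (T : ℚ)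
      = ((2 * d + 4).choose (d + 1) : ℚ) - (d + 2) ^ 2 := by
    rw [hc2]
    simp only [pow_succ] at hD ⊢
    linear_combination hD + (((2 * d + 4).choose (d + 1) : ℚ) - (d + 2) ^ 2
      + (d + 2) * (d + 1) / 2) * hs
  have : 2 * (d + 1) + 2 = 2 * d + 4 := by ring
  rw [this]
  have g2 : ((-(((d + 1 + 1).choose 2 : ℤ)) + T : ℤ) : ℚ)
      = ((((2 * d + 4).choose (d + 1) : ℤ) - ((d + 1 : ℕ) + 1) ^ 2 : ℤ) : ℚ) := by
    push_cast
    rw [show (d + 1 + 1 : ℚ) = d + 2 by ring]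
    exact goalQ
  exact_mod_cast g2
end

section
/- Let n ≥ 2 and d ≥ n + 1 be integers. In ℝⁿ, let Θ be the convex hull of the n points {d·e_j − 𝟙 : 1 ≤ j ≤ n−1} ∪ {−𝟙}, where e_j is the j-th standard basis vector and 𝟙 = (1, …, 1). Then the number of lattice points of ℤⁿ lying in the relative interior (intrinsic interior) of Θ equals the binomial coefficient C(d−1, n−1). -/
theorem aux_lineMap {n : ℕ} {s : Set (Fin n → ℝ)} {x v : Fin n → ℝ}
    (hx : x ∈ intrinsicInterior ℝ s) (hv : v ∈ s) :
    ∃ ε : ℝ, 0 < ε ∧ (fun i => x i - ε * (v i - x i)) ∈ s := by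
  obtain ⟨y, hy, rfl⟩ := mem_intrinsicInterior.1 hx
  have hvs : v ∈ affineSpan ℝ s := subset_affineSpan ℝ s hv
  have hmem : ∀ ε : ℝ, (fun i => (y : Fin n → ℝ) i - ε * (v i - (y : Fin n → ℝ) i))
      ∈ affineSpan ℝ s := by
    intro ε
    have h := AffineMap.lineMap_mem (-ε) y.2 hvs
    convert h using 1
    ext i
    simp [AffineMap.lineMap_apply]
    ring
  let f : ℝ → affineSpan ℝ s := fun ε => ⟨_, hmem ε⟩
  have hf : Continuous f := by
    apply Continuous.subtype_mk
    fun_prop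
  have hf0 : f 0 = y := by
    apply Subtype.ext
    ext i
    simp [f]
  have hnb : f ⁻¹' (interior ((↑) ⁻¹' s : Set (affineSpan ℝ s))) ∈ nhds (0 : ℝ) := by
    apply (isOpen_interior.preimage hf).mem_nhds
    simpa [hf0] using hy
  obtain ⟨δ, hδ, hb⟩ := Metric.mem_nhds_iff.1 hnb
  refine ⟨δ / 2, by positivity, ?_⟩
  have h1 : δ / 2 ∈ Metric.ball (0 : ℝ) δ := by
    rw [Metric.mem_ball, Real.dist_eq, sub_zero, abs_of_pos (by positivity)]
    linarith
  have h2 : f (δ / 2) ∈ ((↑) ⁻¹' s : Set (affineSpan ℝ s)) := interior_subset (hb h1)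
  exact h2

theorem aux_hull (m d : ℕ) (hd : 0 < d) :
    (convexHull ℝ
        ({x : Fin (m+1) → ℝ | ∃ j : Fin (m+1), (j : ℕ) < m + 1 - 1 ∧
            x = fun i => (d : ℝ) * (if i = j then 1 else 0) - 1}
          ∪ {fun _ => (-1 : ℝ)})) =
    {x | x (Fin.last m) = -1 ∧ (∀ i : Fin m, -1 ≤ x i.castSucc) ∧
      ∑ i : Fin m, (x i.castSucc + 1) ≤ (d : ℝ)} := by
  have hd' : (0 : ℝ) < d := by exact_mod_cast hd
  apply Set.Subset.antisymm
  · apply convexHull_min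
    · rintro x (⟨j, hj, rfl⟩ | rfl)
      · have hj' : j ≠ Fin.last m := by
          intro h
          rw [h] at hj
          simp at hj
        obtain ⟨k, rfl⟩ := Fin.exists_castSucc_eq.2 hj'
        refine ⟨by simp [hj'.symm], ?_, ?_⟩
        · intro i
          have : (0 : ℝ) ≤ d * (if i.castSucc = k.castSucc then 1 else 0) := by positivity
          simpa using this
        · simp
      · simp
    · rintro x ⟨hx1, hx2, hx3⟩ y ⟨hy1, hy2, hy3⟩ a b ha hb hab
      refine ⟨?_, ?_, ?_⟩
      · simp only [Pi.add_apply, Pi.smul_apply, smul_eq_mul, hx1, hy1]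
        linarith
      · intro i
        simp only [Pi.add_apply, Pi.smul_apply, smul_eq_mul]
        nlinarith [hx2 i, hy2 i]
      · have : ∑ i : Fin m, ((a • x + b • y) i.castSucc + 1) =
            a * ∑ i : Fin m, (x i.castSucc + 1) + b * ∑ i : Fin m, (y i.castSucc + 1) := by
          rw [Finset.mul_sum, Finset.mul_sum, ← Finset.sum_add_distrib]
          apply Finset.sum_congr rfl
          intro i _
          simp only [Pi.add_apply, Pi.smul_apply, smul_eq_mul]
          linear_combination -hab
        rw [this]
        have : (d : ℝ) = a * d + b * d := by rw [← add_mul, hab, one_mul]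
        rw [this]
        gcongr
  · rintro x ⟨hx1, hx2, hx3⟩
    set S := ({x : Fin (m+1) → ℝ | ∃ j : Fin (m+1), (j : ℕ) < m + 1 - 1 ∧
            x = fun i => (d : ℝ) * (if i = j then 1 else 0) - 1}
          ∪ {fun _ => (-1 : ℝ)}) with hS
    let w : Option (Fin m) → ℝ := fun o =>
      o.elim (1 - ∑ i : Fin m, (x i.castSucc + 1) / d) (fun i => (x i.castSucc + 1) / d)
    let z : Option (Fin m) → (Fin (m+1) → ℝ) := fun o =>
      o.elim (fun _ => -1) (fun j i => (d : ℝ) * (if i = j.castSucc then 1 else 0) - 1)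
    have key := (convex_convexHull ℝ S).sum_mem (t := Finset.univ) (w := w) (z := z) ?_ ?_ ?_
    · convert key using 1
      ext i
      simp only [Fintype.sum_option, w, z, Option.elim, Pi.add_apply, Finset.sum_apply,
        Pi.smul_apply, smul_eq_mul]
      have : ∀ j : Fin m, (x j.castSucc + 1) / d * (d * (if i = j.castSucc then 1 else 0) - 1)
          = (if i = j.castSucc then x j.castSucc + 1 else 0) - (x j.castSucc + 1) / d := by
        intro j
        split_ifs <;> field_simp <;> ring
      simp only [this, Finset.sum_sub_distrib]
      refine Fin.lastCases ?_ (fun k => ?_) i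
      · have h : ∀ j : Fin m, Fin.last m ≠ j.castSucc := fun j => (Fin.castSucc_ne_last j).symm
        simp [h, hx1]
        ring
      · simp
    · rintro (_ | i) _
      · simp only [w, Option.elim]
        rw [← Finset.sum_div, sub_nonneg, div_le_one hd']
        exact hx3
      · simp only [w, Option.elim]
        have := hx2 i
        apply div_nonneg <;> linarith
    · simp [Fintype.sum_option, w]
    · rintro (_ | j) _
      · exact subset_convexHull ℝ S (Or.inr rfl)
      · exact subset_convexHull ℝ S (Or.inl ⟨j.castSucc, by simp, rfl⟩)

theorem aux_int (m d : ℕ) (hd : 0 < d) :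
    intrinsicInterior ℝ
    {x : Fin (m+1) → ℝ | x (Fin.last m) = -1 ∧ (∀ i : Fin m, -1 ≤ x i.castSucc) ∧
      ∑ i : Fin m, (x i.castSucc + 1) ≤ (d : ℝ)} =
    {x | x (Fin.last m) = -1 ∧ (∀ i : Fin m, -1 < x i.castSucc) ∧
      ∑ i : Fin m, (x i.castSucc + 1) < (d : ℝ)} := by
  have hd' : (0 : ℝ) < d := by exact_mod_cast hd
  set T := {x : Fin (m+1) → ℝ | x (Fin.last m) = -1 ∧ (∀ i : Fin m, -1 ≤ x i.castSucc) ∧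
      ∑ i : Fin m, (x i.castSucc + 1) ≤ (d : ℝ)} with hT
  apply Set.Subset.antisymm
  · intro x hx
    obtain ⟨h1, h2, h3⟩ := intrinsicInterior_subset hx
    refine ⟨h1, fun j => ?_, ?_⟩
    · have hv : (fun i => (d : ℝ) * (if i = j.castSucc then 1 else 0) - 1) ∈ T := by
        refine ⟨by simp [(Fin.castSucc_ne_last j).symm], ?_, ?_⟩
        · intro i
          have : (0 : ℝ) ≤ d * (if i.castSucc = j.castSucc then 1 else 0) := by positivity
          simpa using this
        · simp
      obtain ⟨ε, hε, -, g, -⟩ := aux_lineMap hx hv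
      have := g j
      refine lt_of_le_of_ne (h2 j) fun h => ?_
      simp [← h] at this
      nlinarith
    · have hv : (fun _ => -1) ∈ T := by simp [hT]
      obtain ⟨ε, hε, -, -, g⟩ := aux_lineMap hx hv
      refine lt_of_le_of_ne h3 fun h => ?_
      have e : ∑ i : Fin m, (x i.castSucc - ε * (-1 - x i.castSucc) + 1) =
          (1 + ε) * ∑ i : Fin m, (x i.castSucc + 1) := by
        rw [Finset.mul_sum]
        exact Finset.sum_congr rfl fun i _ => by ring
      simp only [e, h] at g
      nlinarith
  · rintro x ⟨h1, h2, h3⟩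
    have hxT : x ∈ T := ⟨h1, fun i => (h2 i).le, h3.le⟩
    have hspan : ∀ y ∈ affineSpan ℝ T, y (Fin.last m) = -1 := by
      intro y hy
      refine affineSpan_induction (p := fun y => y (Fin.last m) = -1) hy (fun y hy => hy.1) ?_
      intro c u v w hu hv hw
      simp [hu, hv, hw]
    refine mem_intrinsicInterior.2 ⟨⟨x, subset_affineSpan ℝ T hxT⟩, ?_, rfl⟩
    refine mem_interior.2 ⟨(↑) ⁻¹' {x : Fin (m+1) → ℝ | (∀ i : Fin m, -1 < x i.castSucc) ∧
      ∑ i : Fin m, (x i.castSucc + 1) < (d : ℝ)}, ?_, ?_, ⟨h2, h3⟩⟩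
    · rintro ⟨y, hy⟩ ⟨g2, g3⟩
      exact ⟨hspan y hy, fun i => (g2 i).le, g3.le⟩
    · apply IsOpen.preimage continuous_subtype_val
      apply IsOpen.and
      · simp only [Set.setOf_forall]
        exact isOpen_iInter_of_finite fun i => isOpen_lt (by fun_prop) (by fun_prop)
      · exact isOpen_lt (by fun_prop) (by fun_prop)

theorem aux_card (m k : ℕ) :
    (Finset.piAntidiag (Finset.univ : Finset (Fin (m+1))) k).card = (m + 1 + k - 1).choose k := by
  have h := Finset.card_finsuppAntidiag_nat_eq_choose (s := (Finset.univ : Finset (Fin (m+1)))) k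
  rw [Finset.card_univ, Fintype.card_fin] at h
  rw [← h]
  simp [Finset.finsuppAntidiag]

/-- Interior lattice point count of the facet `Θ_n` of `Δ_{a₀}`:
`l*(Θ_n) = C(d-1, n-1)`. -/
theorem ncard_interior_lattice_points_facet
    (n d : ℕ) (hn : 2 ≤ n) (hd : n + 1 ≤ d) :
    Set.ncard {p : Fin n → ℤ |
      (fun i => (p i : ℝ)) ∈ intrinsicInterior ℝ (convexHull ℝ
        ({x : Fin n → ℝ | ∃ j : Fin n, (j : ℕ) < n - 1 ∧
            x = fun i => (d : ℝ) * (if i = j then 1 else 0) - 1}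
          ∪ {fun _ => (-1 : ℝ)}))}
      = (d - 1).choose (n - 1) := by
  obtain ⟨m, rfl⟩ : ∃ m, n = m + 1 := ⟨n - 1, by omega⟩
  obtain ⟨k, rfl⟩ : ∃ k, d = m + 1 + k := ⟨d - (m + 1), by omega⟩
  rw [aux_hull m _ (by omega), aux_int m _ (by omega)]
  let g : (Fin (m+1) → ℕ) → (Fin (m+1) → ℤ) := fun r i => if i = Fin.last m then -1 else r i
  have himg : {p : Fin (m+1) → ℤ | (fun i => (p i : ℝ)) ∈
      {x : Fin (m+1) → ℝ | x (Fin.last m) = -1 ∧ (∀ i : Fin m, -1 < x i.castSucc) ∧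
      ∑ i : Fin m, (x i.castSucc + 1) < ((m + 1 + k : ℕ) : ℝ)}} =
      g '' (Finset.piAntidiag (Finset.univ : Finset (Fin (m+1))) k : Set (Fin (m+1) → ℕ)) := by
    ext p
    have hiff : (fun i => (p i : ℝ)) ∈
      {x : Fin (m+1) → ℝ | x (Fin.last m) = -1 ∧ (∀ i : Fin m, -1 < x i.castSucc) ∧
      ∑ i : Fin m, (x i.castSucc + 1) < ((m + 1 + k : ℕ) : ℝ)} ↔
      (p (Fin.last m) = -1 ∧ (∀ i : Fin m, -1 < p i.castSucc) ∧
      ∑ i : Fin m, (p i.castSucc + 1) < ((m + 1 + k : ℕ) : ℤ)) := by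
      simp only [Set.mem_setOf_eq]
      norm_cast
    rw [Set.mem_setOf_eq, hiff]
    simp only [Set.mem_image, Finset.mem_coe, Finset.mem_piAntidiag]
    constructor
    · rintro ⟨h1, h2, h3⟩
      rw [Finset.sum_add_distrib] at h3
      simp at h3
      refine ⟨Fin.snoc (α := fun _ => ℕ) (fun i => (p i.castSucc).toNat)
        (k - ∑ i : Fin m, p i.castSucc).toNat, ⟨?_, by simp⟩, ?_⟩
      · rw [Fin.sum_univ_castSucc]
        simp only [Fin.snoc_castSucc, Fin.snoc_last]
        zify
        rw [Int.toNat_of_nonneg (by linarith)]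
        have : ∀ i : Fin m, ((p i.castSucc).toNat : ℤ) = p i.castSucc := fun i =>
          Int.toNat_of_nonneg (by have := h2 i; omega)
        simp only [this]
        ring
      · ext i
        refine Fin.lastCases ?_ (fun j => ?_) i
        · simp [g, h1]
        · simp only [g, Fin.castSucc_ne_last, if_false, Fin.snoc_castSucc]
          exact Int.toNat_of_nonneg (by have := h2 j; omega)
    · rintro ⟨r, ⟨hr, -⟩, rfl⟩
      rw [Fin.sum_univ_castSucc] at hr
      refine ⟨by simp [g], fun i => ?_, ?_⟩
      · simp only [g, Fin.castSucc_ne_last, if_false]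
        omega
      · simp only [g, Fin.castSucc_ne_last, if_false, Finset.sum_add_distrib]
        zify at hr
        simp
        linarith [Int.natCast_nonneg (r (Fin.last m))]
  rw [himg, Set.ncard_image_of_injOn, Set.ncard_coe_finset, aux_card]
  · simp
    exact (Nat.choose_symm_add).symm
  · intro r hr s hs h
    simp only [Finset.mem_coe, Finset.mem_piAntidiag] at hr hs
    have hc : ∀ i : Fin m, r i.castSucc = s i.castSucc := by
      intro i
      have := congrFun h i.castSucc
      simpa [g, Fin.castSucc_ne_last] using this
    have h1 := hr.1
    have h2 := hs.1
    rw [Fin.sum_univ_castSucc] at h1 h2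
    simp only [hc] at h1
    ext i
    refine Fin.lastCases ?_ (fun j => hc j) i
    omega
end
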